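/- Let K ⊆ ℝ^n be a compact convex set. Then the image of K under the componentwise ReLU map is contained in the convex hull of the union, over all sign patterns s : Fin n → Bool, of the ReLU-images of the extreme points of the orthant pieces: ReLU '' K ⊆ convexHull ℝ (⋃ (s : Fin n → Bool), ReLU '' (Set.extremePoints ℝ (K ∩ O_s))). -/

import Mathlib

theorem exists_support_aux {E : Type} [NormedAddCommGroup E] [NormedSpace ℝ E]
    [FiniteDimensional ℝ E] {C : Set E} (hC : Convex ℝ C) {x : E} (hx : x ∈ closure C)
    (hxC : x ∉ C) : ∃ f : E →L[ℝ] ℝ, f ≠ 0 ∧ ∀ y ∈ closure C, f y ≤ f x := by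
  obtain ⟨c, hc⟩ : C.Nonempty := closure_nonempty_iff.1 ⟨x, hx⟩
  by_cases hi : (interior C).Nonempty
  · obtain ⟨f, hf⟩ := geometric_hahn_banach_open_point hC.interior isOpen_interior
      (fun h => hxC (interior_subset h))
    obtain ⟨z, hz⟩ := hi
    refine ⟨f, ?_, ?_⟩
    · rintro rfl
      simpa using hf z hz
    · intro y hy
      rw [← hC.closure_interior_eq_closure_of_nonempty_interior ⟨z, hz⟩] at hy
      have hcl : IsClosed {y | f y ≤ f x} := isClosed_le f.continuous continuous_const
      exact closure_minimal (fun a ha => (hf a ha).le) hcl hy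
  · rw [hC.interior_nonempty_iff_affineSpan_eq_top] at hi
    have hd : vectorSpan ℝ C < ⊤ := by
      rw [lt_top_iff_ne_top]
      intro h
      exact hi ((AffineSubspace.affineSpan_eq_top_iff_vectorSpan_eq_top_of_nonempty ℝ E E
        ⟨c, hc⟩).2 h)
    obtain ⟨g, hg, hgC⟩ := Submodule.exists_le_ker_of_lt_top _ hd
    have hconst : ∀ y ∈ C, g y = g c := by
      intro y hy
      have := hgC (vsub_mem_vectorSpan ℝ hy hc)
      simpa [sub_eq_zero] using this
    have hcont : Continuous g := g.continuous_of_finiteDimensional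
    have hcl : IsClosed {y | g y = g c} := isClosed_eq hcont continuous_const
    have hconst' : ∀ y ∈ closure C, g y = g c := fun y hy => closure_minimal hconst hcl hy
    refine ⟨g.toContinuousLinearMap, ?_, ?_⟩
    · intro h
      apply hg
      ext v
      exact congrArg (fun k : E →L[ℝ] ℝ => k v) h
    · intro y hy
      simp [hconst' y hy, hconst' x hx]

theorem minkowski_aux (d : ℕ) : ∀ (E : Type) [NormedAddCommGroup E] [NormedSpace ℝ E]
    [FiniteDimensional ℝ E], Module.finrank ℝ E = d → ∀ s : Set E, IsCompact s → Convex ℝ s →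
    s ⊆ convexHull ℝ (Set.extremePoints ℝ s) := by
  induction d using Nat.strong_induction_on with
  | _ d ih =>
  intro E _ _ _ hd s hs hsc x hx
  by_contra hxC
  have hcl := closure_convexHull_extremePoints hs hsc
  obtain ⟨f, hf0, hf⟩ := exists_support_aux (convex_convexHull ℝ _) (by rw [hcl]; exact hx) hxC
  rw [hcl] at hf
  let V : Submodule ℝ E := LinearMap.ker (f : E →ₗ[ℝ] ℝ)
  have hV : ∀ v : V, f v = 0 := fun v => v.2
  have hlt : Module.finrank ℝ V < d := by
    rw [← hd]
    apply Submodule.finrank_lt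
    intro h
    apply hf0
    ext v
    have : v ∈ V := by rw [h]; trivial
    exact this
  let φ : V →ᵃ[ℝ] E := V.subtype.toAffineMap + AffineMap.const ℝ V x
  have hφ : ∀ v : V, φ v = (v : E) + x := fun v => rfl
  have hemb : Topology.IsClosedEmbedding φ :=
    (Homeomorph.addRight x).isClosedEmbedding.comp
      (Submodule.closed_of_finiteDimensional V).isClosedEmbedding_subtypeVal
  have hF := ih _ hlt V rfl (φ ⁻¹' s) (hemb.isCompact_preimage hs) (hsc.affine_preimage φ)
  have h0 : (0 : V) ∈ φ ⁻¹' s := by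
    simpa [hφ] using hx
  have h1 := Set.mem_image_of_mem φ (hF h0)
  rw [AffineMap.image_convexHull] at h1
  apply hxC
  have h2 : φ 0 = x := by simp [hφ]
  rw [h2] at h1
  refine convexHull_mono ?_ h1
  rintro _ ⟨v, hv, rfl⟩
  rw [mem_extremePoints] at hv ⊢
  refine ⟨hv.1, ?_⟩
  intro a ha b hb hab
  have hfa := hf a ha
  have hfb := hf b hb
  obtain ⟨p, q, hp, hq, hpq, hab'⟩ := id hab
  have hfv : p * f a + q * f b = f x := by
    have := congrArg f hab'
    simpa [hφ, hV] using this
  have ha' : f a = f x := by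
    have : p * (f x - f a) + q * (f x - f b) = 0 := by
      linear_combination (-1) * hfv + f x * hpq
    nlinarith [mul_nonneg hp.le (sub_nonneg.2 hfa), mul_nonneg hq.le (sub_nonneg.2 hfb)]
  have hb' : f b = f x := by
    have : p * (f x - f a) + q * (f x - f b) = 0 := by
      linear_combination (-1) * hfv + f x * hpq
    nlinarith [mul_nonneg hp.le (sub_nonneg.2 hfa), mul_nonneg hq.le (sub_nonneg.2 hfb)]
  let a1 : V := ⟨a - x, by simp [V, ha']⟩
  let b1 : V := ⟨b - x, by simp [V, hb']⟩
  have ea : φ a1 = a := by simp [hφ, a1]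
  have eb : φ b1 = b := by simp [hφ, b1]
  have key := hv.2 a1 (by simpa [ea] using ha) b1 (by simpa [eb] using hb)
    ⟨p, q, hp, hq, hpq, by
      apply Subtype.ext
      have h3 : p • a + q • b = (v : E) + x := hab'
      have h4 : p • x + q • x = x := by rw [← add_smul, hpq, one_smul]
      show p • (a - x) + q • (b - x) = (v : E)
      rw [smul_sub, smul_sub, sub_add_sub_comm, h3, h4, add_sub_cancel_right]⟩
  exact ⟨by rw [← key.1, ea], by rw [← key.2, eb]⟩

/-- The ReLU image of a compact convex set is contained in the convex hull of the union over
orthants of the ReLU images of the extreme points of the orthant pieces. -/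
theorem relu_image_subset_convexHull_union {n : ℕ} (K : Set (Fin n → ℝ))
    (hK : IsCompact K) (hKc : Convex ℝ K) :
    (fun x : Fin n → ℝ => fun i => max 0 (x i)) '' K ⊆
      convexHull ℝ (⋃ s : Fin n → Bool,
        (fun x : Fin n → ℝ => fun i => max 0 (x i)) ''
          Set.extremePoints ℝ
            (K ∩ {x : Fin n → ℝ | ∀ i, if s i = true then 0 ≤ x i else x i ≤ 0})) := by
  rintro _ ⟨x, hx, rfl⟩
  let s : Fin n → Bool := fun i => decide (0 ≤ x i)
  let O : Set (Fin n → ℝ) := {x | ∀ i, if s i = true then 0 ≤ x i else x i ≤ 0}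
  have hO : O = ⋂ i, {x : Fin n → ℝ | if s i = true then 0 ≤ x i else x i ≤ 0} := by
    ext y; simp [O]
  have hxO : x ∈ O := by
    intro i
    by_cases h : 0 ≤ x i
    · simp [s, h]
    · simpa [s, h] using (not_le.1 h).le
  have hOcl : IsClosed O := by
    rw [hO]
    refine isClosed_iInter fun i => ?_
    cases s i
    · simpa using isClosed_le (continuous_apply i) continuous_const
    · simpa using isClosed_le continuous_const (continuous_apply i)
  have hOc : Convex ℝ O := by
    rw [hO]
    refine convex_iInter fun i => ?_
    cases s i
    · simpa using convex_halfSpace_le (LinearMap.proj (R := ℝ) (φ := fun _ : Fin n => ℝ) i).isLinear 0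
    · simpa using convex_halfSpace_ge (LinearMap.proj (R := ℝ) (φ := fun _ : Fin n => ℝ) i).isLinear 0
  have hM := minkowski_aux _ (Fin n → ℝ) rfl (K ∩ O) (hK.inter_right hOcl) (hKc.inter hOc)
    ⟨hx, hxO⟩
  let D : (Fin n → ℝ) →ₗ[ℝ] (Fin n → ℝ) :=
    LinearMap.pi fun i => (if s i = true then (1 : ℝ) else 0) • LinearMap.proj i
  have hD : ∀ y ∈ O, D y = fun i => max 0 (y i) := by
    intro y hy
    ext i
    have := hy i
    by_cases h : s i = true
    · simp only [h, if_true] at this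
      simp [D, h, this]
    · simp only [h] at this
      simp only [Bool.false_eq_true, if_false] at this
      simp [D, h, this]
  have h1 := Set.mem_image_of_mem D hM
  rw [LinearMap.image_convexHull, hD x hxO] at h1
  refine convexHull_mono ?_ h1
  rintro _ ⟨y, hy, rfl⟩
  exact Set.mem_iUnion.2 ⟨s, y, hy, (hD y hy.1.2).symm⟩
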